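/- arXiv:1912.08137 — 2 statements merged into one kernel-verified Lean document; each statement's English description precedes it below -/
import Mathlib

section
/- There exists an absolute constant C > 0 such that for every integer q ≥ 2, every primitive Dirichlet character χ modulo q with q > 1, and every real number x ≥ 1, one has |∑_{1 ≤ n ≤ x} χ(n)| ≤ C · q^{1/2} · log q. -/
open Finset

open ZMod AddChar in
/-- The Gauss sum of a primitive Dirichlet character modulo `q` has absolute value `√q`. -/
lemma DirichletCharacter.IsPrimitive.norm_gaussSum_stdAddChar {q : ℕ} [NeZero q]
    {χ : DirichletCharacter ℂ q} (hχ : χ.IsPrimitive) :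
    ‖gaussSum χ stdAddChar‖ = Real.sqrt q := by
  have hdft : 𝓕 (𝓕 χ) (-1) = (q : ℂ) := by simp [dft_dft]
  have hstar : star (gaussSum χ (stdAddChar (N := q))) = ∑ k : ZMod q, χ⁻¹ (-k) * stdAddChar k := by
    rw [star_gaussSum_eq, gaussSum, ← Equiv.sum_comp (Equiv.neg (ZMod q))]
    simp
  have hmul : gaussSum χ (stdAddChar (N := q)) * star (gaussSum χ stdAddChar) = (q : ℂ) := by
    rw [← hdft, dft_apply, hstar, Finset.mul_sum]
    refine Finset.sum_congr rfl fun k _ ↦ ?_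
    rw [hχ.fourierTransform_eq_inv_mul_gaussSum]
    simp only [smul_eq_mul, mul_neg, mul_one, neg_neg]
    ring
  have hsq : ‖gaussSum χ (stdAddChar (N := q))‖ ^ 2 = (q : ℝ) := by
    simpa [sq] using congrArg norm hmul
  rw [← hsq, Real.sqrt_sq (norm_nonneg _)]

/-- A concave-parabola lower bound for `sin (π t)` on `[0, 1]`. -/
lemma two_mul_mul_one_sub_le_sin_pi_mul {t : ℝ} (h0 : 0 ≤ t) (h1 : t ≤ 1) :
    2 * t * (1 - t) ≤ Real.sin (Real.pi * t) := by
  have hpi := Real.pi_pos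
  rcases le_total t (1 / 2) with h | h
  · have := Real.mul_le_sin (x := Real.pi * t) (by positivity) (by nlinarith)
    rw [← mul_assoc, div_mul_cancel₀ _ hpi.ne'] at this
    nlinarith
  · have := Real.mul_le_sin (x := Real.pi * (1 - t)) (mul_nonneg hpi.le (by linarith))
      (by nlinarith)
    rw [← mul_assoc, div_mul_cancel₀ _ hpi.ne',
      show Real.pi * (1 - t) = Real.pi - Real.pi * t by ring, Real.sin_pi_sub] at this
    nlinarith

open ZMod in
lemma four_mul_mul_one_sub_le_norm_stdAddChar_sub_one {q : ℕ} [NeZero q] (k : ZMod q) :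
    4 * ((k.val : ℝ) / q) * (1 - k.val / q) ≤ ‖stdAddChar k - 1‖ := by
  have hq : (0 : ℝ) < q := by exact_mod_cast NeZero.pos q
  have hk : (k.val : ℝ) / q ≤ 1 := by
    rw [div_le_one hq]; exact_mod_cast k.val_lt.le
  have hexp : stdAddChar k = Complex.exp (.I * ((2 * (Real.pi * (k.val / q)) : ℝ) : ℂ)) := by
    conv_lhs => rw [← ZMod.natCast_zmod_val k, ← Int.cast_natCast, stdAddChar_coe]
    congr 1
    push_cast
    ring
  rw [hexp, Complex.norm_exp_I_mul_ofReal_sub_one, Real.norm_eq_abs,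
    mul_div_cancel_left₀ _ (two_ne_zero' ℝ)]
  have := two_mul_mul_one_sub_le_sin_pi_mul (div_nonneg (Nat.cast_nonneg _) hq.le) hk
  refine le_trans ?_ (le_abs_self _)
  linarith

open ZMod in
/-- Bound for incomplete sums of a nontrivial additive character modulo `q`. -/
lemma norm_sum_Icc_stdAddChar_le {q : ℕ} [NeZero q] {k : ZMod q} (hk : k ≠ 0) (N : ℕ) :
    ‖∑ n ∈ Finset.Icc 1 N, stdAddChar (k * (n : ZMod q))‖ ≤
      q / 2 * ((k.val : ℝ)⁻¹ + ((q : ℝ) - k.val)⁻¹) := by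
  have hq : (0 : ℝ) < q := by exact_mod_cast NeZero.pos q
  have hk0 : (0 : ℝ) < k.val := by exact_mod_cast ZMod.val_pos.mpr hk
  have hkq : (0 : ℝ) < (q : ℝ) - k.val := sub_pos.mpr (by exact_mod_cast k.val_lt)
  have hnorm (a : ZMod q) : ‖stdAddChar a‖ = 1 := by
    rw [stdAddChar_apply, Circle.norm_coe]
  have hlow := four_mul_mul_one_sub_le_norm_stdAddChar_sub_one k
  have hpos : 0 < 4 * ((k.val : ℝ) / q) * (1 - k.val / q) := by
    rw [one_sub_div hq.ne']; positivity
  have hne : stdAddChar k ≠ 1 := fun h ↦ by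
    rw [h, sub_self, norm_zero] at hlow; linarith
  have hgeom : ∑ n ∈ Finset.Icc 1 N, stdAddChar (k * (n : ZMod q)) =
      stdAddChar k * ((stdAddChar k ^ N - 1) / (stdAddChar k - 1)) := by
    rw [← geom_sum_eq hne, Finset.mul_sum, ← Finset.Ico_add_one_right_eq_Icc,
      Finset.sum_Ico_eq_sum_range]
    refine Finset.sum_congr rfl fun n _ ↦ ?_
    rw [← AddChar.map_nsmul_eq_pow, ← AddChar.map_add_eq_mul]
    congr 1
    push_cast
    rw [nsmul_eq_mul]
    ring
  rw [hgeom, norm_mul, hnorm, one_mul, norm_div]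
  have hnum : ‖stdAddChar k ^ N - 1‖ ≤ 2 := by
    refine (norm_sub_le _ _).trans ?_
    rw [norm_pow, hnorm, one_pow, norm_one]
    norm_num
  calc ‖stdAddChar k ^ N - 1‖ / ‖stdAddChar k - 1‖
      ≤ 2 / (4 * ((k.val : ℝ) / q) * (1 - k.val / q)) := by gcongr
    _ = q / 2 * ((k.val : ℝ)⁻¹ + ((q : ℝ) - k.val)⁻¹) := by
      rw [one_sub_div hq.ne']
      field_simp
      ring

lemma sum_zmod_inv_val_add_inv_sub_val_le (q : ℕ) [NeZero q] :
    ∑ k : ZMod q, ((k.val : ℝ)⁻¹ + ((q : ℝ) - k.val)⁻¹) ≤ 2 * (1 + Real.log q) := by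
  have hH : ∑ j ∈ Finset.range q, ((j + 1 : ℕ) : ℝ)⁻¹ ≤ 1 + Real.log q := by
    simpa [harmonic] using harmonic_le_one_add_log q
  have hval : ∑ k : ZMod q, ((k.val : ℝ)⁻¹ + ((q : ℝ) - k.val)⁻¹) =
      ∑ j ∈ Finset.range q, ((j : ℝ)⁻¹ + ((q : ℝ) - j)⁻¹) := by
    obtain ⟨m, rfl⟩ := Nat.exists_eq_succ_of_ne_zero (NeZero.ne q)
    exact Fin.sum_univ_eq_sum_range (fun j ↦ (j : ℝ)⁻¹ + (((m + 1 : ℕ) : ℝ) - j)⁻¹) (m + 1)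
  have hfst : ∑ j ∈ Finset.range q, (j : ℝ)⁻¹ ≤ ∑ j ∈ Finset.range q, ((j + 1 : ℕ) : ℝ)⁻¹ := by
    have := Finset.sum_range_succ' (fun j : ℕ ↦ (j : ℝ)⁻¹) q
    rw [Finset.sum_range_succ] at this
    simp only [Nat.cast_zero, inv_zero, add_zero] at this
    rw [← this]
    exact le_add_of_nonneg_right (by positivity)
  have hsnd : ∑ j ∈ Finset.range q, ((q : ℝ) - j)⁻¹ =
      ∑ j ∈ Finset.range q, ((j + 1 : ℕ) : ℝ)⁻¹ := by
    rw [← Finset.sum_range_reflect]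
    refine Finset.sum_congr rfl fun j hj ↦ ?_
    have hj := Finset.mem_range.mp hj
    rw [← Nat.cast_sub (by omega), show q - (q - 1 - j) = j + 1 by omega]
  rw [hval, Finset.sum_add_distrib, hsnd]
  linarith

open ZMod in
/-- An explicit form of the Pólya–Vinogradov inequality. -/
lemma DirichletCharacter.IsPrimitive.norm_sum_Icc_le {q : ℕ} (hq : 2 ≤ q)
    {χ : DirichletCharacter ℂ q} (hχ : χ.IsPrimitive) (N : ℕ) :
    ‖∑ n ∈ Finset.Icc 1 N, χ (n : ZMod q)‖ ≤ Real.sqrt q * (1 + Real.log q) := by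
  have : NeZero q := ⟨by omega⟩
  have : Fact (1 < q) := ⟨hq⟩
  have hq0 : (0 : ℝ) < q := by exact_mod_cast NeZero.pos q
  have hχn (n : ZMod q) : χ n = (q : ℂ)⁻¹ *
      ∑ k : ZMod q, stdAddChar (k * n) * (χ⁻¹ (-k) * gaussSum χ stdAddChar) := by
    conv_lhs => rw [← LinearEquiv.symm_apply_apply dft (χ : ZMod q → ℂ), invDFT_apply]
    simp only [smul_eq_mul, hχ.fourierTransform_eq_inv_mul_gaussSum]
  have hsum : ∑ n ∈ Finset.Icc 1 N, χ (n : ZMod q) = (q : ℂ)⁻¹ * ∑ k : ZMod q,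
      (∑ n ∈ Finset.Icc 1 N, stdAddChar (k * (n : ZMod q))) *
        (χ⁻¹ (-k) * gaussSum χ stdAddChar) := by
    simp_rw [fun n : ℕ ↦ hχn n, ← Finset.mul_sum, Finset.sum_mul]
    rw [Finset.sum_comm]
  have hterm (k : ZMod q) : ‖(∑ n ∈ Finset.Icc 1 N, stdAddChar (k * (n : ZMod q))) *
      (χ⁻¹ (-k) * gaussSum χ stdAddChar)‖ ≤
        q / 2 * ((k.val : ℝ)⁻¹ + ((q : ℝ) - k.val)⁻¹) * Real.sqrt q := by
    rw [norm_mul, norm_mul, hχ.norm_gaussSum_stdAddChar]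
    by_cases hk : k = 0
    · subst hk
      rw [neg_zero, MulChar.map_nonunit _ not_isUnit_zero, ZMod.val_zero]
      simp only [norm_zero, zero_mul, mul_zero, Nat.cast_zero, sub_zero]
      positivity
    · have h1 := norm_sum_Icc_stdAddChar_le hk N
      have h2 : ‖χ⁻¹ (-k)‖ ≤ 1 := DirichletCharacter.norm_le_one _ _
      exact mul_le_mul h1 (mul_le_of_le_one_left (Real.sqrt_nonneg _) h2) (by positivity)
        ((norm_nonneg _).trans h1)
  rw [hsum, norm_mul, norm_inv, Complex.norm_natCast]
  calc (q : ℝ)⁻¹ * ‖∑ k : ZMod q, (∑ n ∈ Finset.Icc 1 N, stdAddChar (k * (n : ZMod q))) *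
        (χ⁻¹ (-k) * gaussSum χ stdAddChar)‖
      ≤ (q : ℝ)⁻¹ * ∑ k : ZMod q,
          q / 2 * ((k.val : ℝ)⁻¹ + ((q : ℝ) - k.val)⁻¹) * Real.sqrt q := by
        gcongr
        exact norm_sum_le_of_le _ fun k _ ↦ hterm k
    _ = Real.sqrt q / 2 * ∑ k : ZMod q, ((k.val : ℝ)⁻¹ + ((q : ℝ) - k.val)⁻¹) := by
        rw [← Finset.sum_mul, ← Finset.mul_sum]
        field_simp
    _ ≤ Real.sqrt q / 2 * (2 * (1 + Real.log q)) := by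
        gcongr
        exact sum_zmod_inv_val_add_inv_sub_val_le q
    _ = Real.sqrt q * (1 + Real.log q) := by ring

/-- The Pólya–Vinogradov inequality: there is an absolute constant `C > 0` such that
for every integer `q ≥ 2`, every primitive Dirichlet character `χ` modulo `q`, and
every real `x ≥ 1`, we have `|∑_{1 ≤ n ≤ x} χ(n)| ≤ C √q log q`. -/
theorem polya_vinogradov :
    ∃ C : ℝ, 0 < C ∧ ∀ (q : ℕ), 2 ≤ q → ∀ χ : DirichletCharacter ℂ q, χ.IsPrimitive →
      ∀ x : ℝ, 1 ≤ x →
        ‖∑ n ∈ Finset.Icc 1 ⌊x⌋₊, χ (n : ZMod q)‖ ≤ C * Real.sqrt q * Real.log q := by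
  refine ⟨3, by norm_num, fun q hq χ hχ x _ ↦ (hχ.norm_sum_Icc_le hq _).trans ?_⟩
  have hlog : Real.log 2 ≤ Real.log q :=
    Real.log_le_log two_pos (by exact_mod_cast hq)
  have hlog2 := Real.log_two_gt_d9
  calc Real.sqrt q * (1 + Real.log q) ≤ Real.sqrt q * (3 * Real.log q) := by
        gcongr
        linarith
    _ = 3 * Real.sqrt q * Real.log q := by ring
end

section
/- There exists a constant C > 0 such that for every real R ≥ 1, the number of lattice points (a, b) ∈ ℤ² with a² + b² ≤ R satisfies |#{(a,b) ∈ ℤ² : a² + b² ≤ R} − π R| ≤ C · R^{1/3}. -/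
/-- The additive character `x ↦ exp (2πix)`. -/
noncomputable def expTwoPi (x : ℝ) : ℂ := Complex.exp ((2 * Real.pi * x : ℝ) * Complex.I)

lemma norm_expTwoPi (x : ℝ) : ‖expTwoPi x‖ = 1 := Complex.norm_exp_ofReal_mul_I _

lemma expTwoPi_add (x y : ℝ) : expTwoPi (x + y) = expTwoPi x * expTwoPi y := by
  rw [expTwoPi, expTwoPi, expTwoPi, ← Complex.exp_add]
  push_cast
  ring_nf

lemma expTwoPi_sub_int (x : ℝ) (k : ℤ) : expTwoPi (x - k) = expTwoPi x := by
  rw [expTwoPi, expTwoPi, Complex.exp_eq_exp_iff_exists_int]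
  exact ⟨-k, by push_cast; ring⟩

lemma norm_sum_expTwoPi_le_card {ι : Type*} (s : Finset ι) (x : ι → ℝ) :
    ‖∑ n ∈ s, expTwoPi (x n)‖ ≤ s.card := by
  refine (norm_sum_le _ _).trans ?_
  simp [norm_expTwoPi]

/-- Since `c (1 - expTwoPi t) = 1` for this `c`, it serves as the Abel summation weight. -/
noncomputable def cotWeight (t : ℝ) : ℂ := 1 / 2 + (Real.cot (Real.pi * t) / 2 : ℝ) * Complex.I

lemma cotWeight_mul {t : ℝ} (h : Real.sin (Real.pi * t) ≠ 0) :
    cotWeight t * (1 - expTwoPi t) = 1 := by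
  have h' : expTwoPi t = ((2 * Real.cos (Real.pi * t) ^ 2 - 1 : ℝ) : ℂ)
      + ((2 * Real.sin (Real.pi * t) * Real.cos (Real.pi * t) : ℝ) : ℂ) * Complex.I := by
    rw [expTwoPi, Complex.exp_mul_I, ← Complex.ofReal_cos, ← Complex.ofReal_sin, mul_assoc,
      Real.cos_two_mul, Real.sin_two_mul]
  have hs := Real.sin_sq_add_cos_sq (Real.pi * t)
  rw [cotWeight, h', Real.cot_eq_cos_div_sin]
  generalize Real.sin (Real.pi * t) = s at *
  generalize Real.cos (Real.pi * t) = c at *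
  have hI := Complex.I_sq
  have hsC : (s : ℂ) ^ 2 + (c : ℂ) ^ 2 = 1 := by exact_mod_cast hs
  have h0 : (s : ℂ) ≠ 0 := by exact_mod_cast h
  push_cast
  field_simp
  linear_combination -2 * Complex.I * c * hsC - 2 * s * c ^ 2 * hI

lemma two_mul_le_sin_pi_mul {t Δ : ℝ} (h0 : 0 < Δ) (h1 : Δ ≤ t) (h2 : t ≤ 1 - Δ) :
    2 * Δ ≤ Real.sin (Real.pi * t) := by
  have hp := Real.pi_pos
  rcases le_total t (1 / 2) with h | h
  · have := Real.mul_le_sin (x := Real.pi * t) (mul_nonneg hp.le (by linarith))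
      (by nlinarith)
    have h3 : 2 / Real.pi * (Real.pi * t) = 2 * t := by field_simp
    linarith
  · have := Real.mul_le_sin (x := Real.pi * (1 - t)) (mul_nonneg hp.le (by linarith))
      (by nlinarith)
    have h3 : 2 / Real.pi * (Real.pi * (1 - t)) = 2 * (1 - t) := by field_simp
    have h4 : Real.sin (Real.pi * (1 - t)) = Real.sin (Real.pi * t) := by
      rw [mul_sub, mul_one, Real.sin_pi_sub]
    linarith

lemma abs_cot_le {t Δ : ℝ} (h0 : 0 < Δ) (h1 : Δ ≤ t) (h2 : t ≤ 1 - Δ) :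
    |Real.cot (Real.pi * t)| ≤ 1 / (2 * Δ) := by
  have hs := two_mul_le_sin_pi_mul h0 h1 h2
  rw [Real.cot_eq_cos_div_sin, abs_div, abs_of_pos (by linarith : 0 < Real.sin (Real.pi * t))]
  exact div_le_div₀ zero_le_one (Real.abs_cos_le_one _) (by positivity) hs

lemma norm_cotWeight_le {t Δ : ℝ} (h0 : 0 < Δ) (h1 : Δ ≤ t) (h2 : t ≤ 1 - Δ) :
    ‖cotWeight t‖ ≤ 1 / (2 * Δ) := by
  have hc := abs_cot_le h0 h1 h2
  have h3 : 1 ≤ 1 / (2 * Δ) := by rw [le_div_iff₀ (by positivity)]; linarith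
  refine (norm_add_le _ _).trans ?_
  rw [norm_mul, Complex.norm_I, mul_one, Complex.norm_real, Real.norm_eq_abs, abs_div]
  norm_num
  norm_num at hc h3
  linarith

lemma cot_le_cot {s t Δ : ℝ} (h0 : 0 < Δ) (h1 : Δ ≤ s) (hst : s ≤ t) (h2 : t ≤ 1 - Δ) :
    Real.cot (Real.pi * t) ≤ Real.cot (Real.pi * s) := by
  have hs := two_mul_le_sin_pi_mul h0 h1 (hst.trans h2)
  have ht := two_mul_le_sin_pi_mul h0 (h1.trans hst) h2
  have hd : 0 ≤ Real.sin (Real.pi * t - Real.pi * s) :=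
    Real.sin_nonneg_of_nonneg_of_le_pi (by nlinarith [Real.pi_pos]) (by nlinarith [Real.pi_pos])
  rw [Real.sin_sub] at hd
  rw [Real.cot_eq_cos_div_sin, Real.cot_eq_cos_div_sin, div_le_div_iff₀ (by linarith) (by linarith)]
  linarith

/-- The Kusmin–Landau inequality. -/
lemma norm_sum_range_expTwoPi_le (x t : ℕ → ℝ) (k : ℤ) {Δ : ℝ} (h0 : 0 < Δ) (N : ℕ)
    (ht : ∀ n, t n = x (n + 1) - x n - k)
    (h1 : ∀ n < N, Δ ≤ t n) (h2 : ∀ n < N, t n ≤ 1 - Δ)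
    (hm : ∀ n, n + 1 < N → t n ≤ t (n + 1)) :
    ‖∑ n ∈ Finset.range N, expTwoPi (x n)‖ ≤ 2 / Δ := by
  rcases N with _ | m
  · simp; positivity
  have hstep : ∀ n < m + 1, expTwoPi (x n) =
      cotWeight (t n) * (expTwoPi (x n) - expTwoPi (x (n + 1))) := by
    intro n hn
    have hs := two_mul_le_sin_pi_mul h0 (h1 n hn) (h2 n hn)
    have he : expTwoPi (x (n + 1)) = expTwoPi (x n) * expTwoPi (t n) := by
      rw [ht, expTwoPi_sub_int, ← expTwoPi_add]; congr 1; ring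
    have hc := cotWeight_mul (t := t n) (by linarith)
    rw [he]
    linear_combination -expTwoPi (x n) * hc
  have habel : ∀ j < m + 1, ∑ n ∈ Finset.range (j + 1), expTwoPi (x n) =
      cotWeight (t 0) * expTwoPi (x 0) - cotWeight (t j) * expTwoPi (x (j + 1)) +
        ∑ n ∈ Finset.range j, (cotWeight (t (n + 1)) - cotWeight (t n)) * expTwoPi (x (n + 1)) := by
    intro j
    induction j with
    | zero =>
      intro hj
      rw [Finset.sum_range_one, Finset.sum_range_zero]
      linear_combination hstep 0 hj
    | succ j ih =>
      intro hj
      rw [Finset.sum_range_succ, ih (by omega), Finset.sum_range_succ]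
      linear_combination hstep (j + 1) hj
  have hvar : ∀ j < m + 1, ‖∑ n ∈ Finset.range j,
      (cotWeight (t (n + 1)) - cotWeight (t n)) * expTwoPi (x (n + 1))‖ ≤
      (Real.cot (Real.pi * t 0) - Real.cot (Real.pi * t j)) / 2 := by
    intro j
    induction j with
    | zero => intro _; simp
    | succ j ih =>
      intro hj
      rw [Finset.sum_range_succ]
      refine (norm_add_le _ _).trans ?_
      have hc := cot_le_cot h0 (h1 j (by omega)) (hm j hj) (h2 (j + 1) hj)
      have : ‖(cotWeight (t (j + 1)) - cotWeight (t j)) * expTwoPi (x (j + 1))‖ =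
          (Real.cot (Real.pi * t j) - Real.cot (Real.pi * t (j + 1))) / 2 := by
        rw [norm_mul, norm_expTwoPi, mul_one, cotWeight, cotWeight, add_sub_add_left_eq_sub,
          ← sub_mul, norm_mul, Complex.norm_I, mul_one, ← Complex.ofReal_sub, Complex.norm_real,
          Real.norm_eq_abs, abs_of_nonpos (by linarith)]
        ring
      have := ih (by omega)
      linarith
  rw [habel m (by omega)]
  have a1 := norm_cotWeight_le h0 (h1 0 (by omega)) (h2 0 (by omega))
  have a2 := norm_cotWeight_le h0 (h1 m (by omega)) (h2 m (by omega))
  have b1 := abs_le.1 (abs_cot_le h0 (h1 0 (by omega)) (h2 0 (by omega)))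
  have b2 := abs_le.1 (abs_cot_le h0 (h1 m (by omega)) (h2 m (by omega)))
  have hv := hvar m (by omega)
  have h3 : 2 / Δ = 4 * (1 / (2 * Δ)) := by field_simp; norm_num
  have h4 : 0 < 1 / (2 * Δ) := by positivity
  refine (norm_add_le _ _).trans ?_
  refine (add_le_add_left (norm_sub_le _ _) _).trans ?_
  rw [norm_mul, norm_mul, norm_expTwoPi, norm_expTwoPi, h3]
  linarith [b1.2, b2.1]

lemma exists_eq_Ico_of_convex (s : Finset ℕ)
    (h : ∀ a ∈ s, ∀ b ∈ s, ∀ n, a ≤ n → n ≤ b → n ∈ s) : ∃ a b, s = Finset.Ico a b := by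
  rcases s.eq_empty_or_nonempty with rfl | hs
  · exact ⟨0, 0, by simp⟩
  · refine ⟨s.min' hs, s.max' hs + 1, Finset.ext fun n => ?_⟩
    rw [Finset.mem_Ico, Nat.lt_succ_iff]
    exact ⟨fun hn => ⟨s.min'_le n hn, s.le_max' n hn⟩,
      fun hn => h _ (s.min'_mem hs) _ (s.max'_mem hs) n hn.1 hn.2⟩

section SecondDifference

variable {D : ℕ → ℝ} {N : ℕ} {lam : ℝ}

lemma add_mul_le_of_le_diff (h : ∀ n, n + 1 < N → D n + lam ≤ D (n + 1)) {i j : ℕ} (hij : i ≤ j)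
    (hj : j < N) : D i + lam * (j - i) ≤ D j := by
  induction j, hij using Nat.le_induction with
  | base => simp
  | succ j hij ih =>
    have := ih (by omega)
    have := h j hj
    push_cast
    linarith

lemma le_add_mul_of_diff_le (h : ∀ n, n + 1 < N → D (n + 1) ≤ D n + lam) {i j : ℕ} (hij : i ≤ j)
    (hj : j < N) : D j ≤ D i + lam * (j - i) := by
  induction j, hij using Nat.le_induction with
  | base => simp
  | succ j hij ih =>
    have := ih (by omega)
    have := h j hj
    push_cast
    linarith

lemma card_le_of_le_diff (hl : 0 < lam) (h : ∀ n, n + 1 < N → D n + lam ≤ D (n + 1)) {c Δ : ℝ}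
    (hΔ : 0 ≤ Δ) (s : Finset ℕ) (hs : ∀ n ∈ s, n < N ∧ c ≤ D n ∧ D n ≤ c + Δ) :
    (s.card : ℝ) ≤ Δ / lam + 1 := by
  rcases s.eq_empty_or_nonempty with rfl | hne
  · simp; positivity
  · set a := s.min' hne
    set b := s.max' hne
    have hab : a ≤ b := s.min'_le b (s.max'_mem hne)
    have h1 := hs a (s.min'_mem hne)
    have h2 := hs b (s.max'_mem hne)
    have h3 := add_mul_le_of_le_diff h hab h2.1
    have h4 : s ⊆ Finset.Icc a b := fun n hn =>
      Finset.mem_Icc.2 ⟨s.min'_le n hn, s.le_max' n hn⟩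
    have h5 := Finset.card_le_card h4
    rw [Nat.card_Icc] at h5
    have h6 : (s.card : ℝ) ≤ b - a + 1 := by
      have : s.card + a ≤ b + 1 := by omega
      have : (s.card : ℝ) + a ≤ b + 1 := by exact_mod_cast this
      linarith
    have h7 : (b : ℝ) - a ≤ Δ / lam := by
      rw [le_div_iff₀ hl]
      linarith [h1.2.1, h2.2.2]
    linarith

lemma norm_sum_expTwoPi_middle_le (x : ℕ → ℝ) (hD : ∀ n, D n = x (n + 1) - x n)
    (h : ∀ n, n + 1 < N → D n ≤ D (n + 1)) {Δ : ℝ} (hΔ : 0 < Δ) (k : ℤ) (s : Finset ℕ)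
    (hs : ∀ n, n ∈ s ↔ n < N ∧ k + Δ ≤ D n ∧ D n ≤ k + 1 - Δ) :
    ‖∑ n ∈ s, expTwoPi (x n)‖ ≤ 2 / Δ := by
  have hmono : ∀ i j, i ≤ j → j < N → D i ≤ D j := fun i j hij hj => by
    simpa using add_mul_le_of_le_diff (lam := 0) (by simpa using h) hij hj
  obtain ⟨a, b, rfl⟩ := exists_eq_Ico_of_convex s (by
    intro a ha b hb n han hnb
    rw [hs] at *
    have := hmono a n han (by omega)
    have := hmono n b hnb hb.1
    refine ⟨by omega, by linarith, by linarith⟩)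
  rw [Finset.sum_Ico_eq_sum_range]
  have hmem : ∀ n < b - a, a + n ∈ Finset.Ico a b := fun n hn => by
    rw [Finset.mem_Ico]; omega
  refine norm_sum_range_expTwoPi_le (fun n => x (a + n)) (fun n => D (a + n) - k) k hΔ (b - a)
    (fun n => by rw [hD, add_assoc]) ?_ ?_ ?_
  · intro n hn
    have := (hs _).1 (hmem n hn)
    linarith [this.2.1]
  · intro n hn
    have := (hs _).1 (hmem n hn)
    linarith [this.2.2]
  · intro n hn
    have := (hs _).1 (hmem (n + 1) hn)
    have := h (a + n) this.1
    simp only [← add_assoc]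
    linarith

lemma norm_sum_expTwoPi_fiber_le (x : ℕ → ℝ) (hD : ∀ n, D n = x (n + 1) - x n) (hl : 0 < lam)
    (h : ∀ n, n + 1 < N → D n + lam ≤ D (n + 1)) {Δ : ℝ} (hΔ : 0 < Δ) (k : ℤ) :
    ‖∑ n ∈ Finset.range N with ⌊D n⌋ = k, expTwoPi (x n)‖ ≤ 2 * (Δ / lam + 1) + 2 / Δ := by
  rw [← Finset.sum_filter_add_sum_filter_not _ (fun n => D n < k + Δ),
    ← Finset.sum_filter_add_sum_filter_not (Finset.filter (fun n => ¬ D n < k + Δ) _)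
      (fun n => D n ≤ k + 1 - Δ)]
  refine (norm_add_le _ _).trans ?_
  refine (add_le_add_right (norm_add_le _ _) _).trans ?_
  have h1 := (norm_sum_expTwoPi_le_card (Finset.filter (fun n => D n < k + Δ)
    (Finset.filter (fun n => ⌊D n⌋ = k) (Finset.range N))) x).trans
    (card_le_of_le_diff hl h (c := k) hΔ.le _ (by
      intro n hn
      simp only [Finset.mem_filter, Finset.mem_range, Int.floor_eq_iff] at hn
      exact ⟨hn.1.1, hn.1.2.1, hn.2.le⟩))
  have h2 := norm_sum_expTwoPi_middle_le x hD (fun n hn => by linarith [h n hn]) hΔ k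
    (Finset.filter (fun n => D n ≤ k + 1 - Δ) (Finset.filter (fun n => ¬ D n < k + Δ)
    (Finset.filter (fun n => ⌊D n⌋ = k) (Finset.range N)))) (by
      intro n
      simp only [Finset.mem_filter, Finset.mem_range, Int.floor_eq_iff, not_lt]
      constructor
      · rintro ⟨⟨⟨a, b⟩, c⟩, d⟩
        exact ⟨a, c, d⟩
      · rintro ⟨a, c, d⟩
        exact ⟨⟨⟨a, by linarith, by linarith⟩, c⟩, d⟩)
  have h3 := (norm_sum_expTwoPi_le_card (Finset.filter (fun n => ¬ D n ≤ k + 1 - Δ)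
    (Finset.filter (fun n => ¬ D n < k + Δ)
    (Finset.filter (fun n => ⌊D n⌋ = k) (Finset.range N)))) x).trans
    (card_le_of_le_diff hl h (c := k + 1 - Δ) hΔ.le _ (by
      intro n hn
      simp only [Finset.mem_filter, Finset.mem_range, Int.floor_eq_iff, not_lt, not_le] at hn
      exact ⟨hn.1.1.1, hn.2.le, by linarith [hn.1.1.2.2]⟩))
  linarith

/-- Van der Corput's second derivative test, stated for second differences. -/
lemma norm_sum_expTwoPi_le_of_second_diff (x : ℕ → ℝ) (hD : ∀ n, D n = x (n + 1) - x n)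
    (hl : 0 < lam) {α : ℝ} (hα : 1 ≤ α)
    (h : ∀ n, n + 1 < N → D n + lam ≤ D (n + 1))
    (h' : ∀ n, n + 1 < N → D (n + 1) ≤ D n + α * lam) :
    ‖∑ n ∈ Finset.range N, expTwoPi (x n)‖ ≤ 6 * α * N * √lam + 12 / √lam := by
  have hs : 0 < √lam := Real.sqrt_pos.2 hl
  have hsq : √lam * √lam = lam := Real.mul_self_sqrt hl.le
  rcases le_or_gt lam 1 with h1 | h1
  · rcases Nat.eq_zero_or_pos N with rfl | hN
    · simp; positivity
    have hs1 : √lam ≤ 1 := Real.sqrt_le_one.2 h1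
    have hmaps : ∀ n ∈ Finset.range N, ⌊D n⌋ ∈ Finset.Icc ⌊D 0⌋ ⌊D (N - 1)⌋ := by
      intro n hn
      rw [Finset.mem_range] at hn
      have hmono : ∀ i j, i ≤ j → j < N → D i ≤ D j := fun i j hij hj => by
        simpa using add_mul_le_of_le_diff (lam := 0)
          (fun n hn => by linarith [h n hn]) hij hj
      exact Finset.mem_Icc.2 ⟨Int.floor_le_floor (hmono _ _ (by omega) hn),
        Int.floor_le_floor (hmono _ _ (by omega) (by omega))⟩
    rw [← Finset.sum_fiberwise_of_maps_to hmaps]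
    refine (norm_sum_le_of_le _
      (fun k _ => norm_sum_expTwoPi_fiber_le x hD hl h hs k)).trans ?_
    rw [Finset.sum_const, nsmul_eq_mul]
    have hfl : ⌊D 0⌋ ≤ ⌊D (N - 1)⌋ :=
      (Finset.mem_Icc.1 (hmaps 0 (Finset.mem_range.2 hN))).2
    have hcard : ((Finset.Icc ⌊D 0⌋ ⌊D (N - 1)⌋).card : ℝ) ≤ α * lam * N + 2 := by
      have e1 : ((Finset.Icc ⌊D 0⌋ ⌊D (N - 1)⌋).card : ℝ) = ⌊D (N - 1)⌋ + 1 - ⌊D 0⌋ := by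
        rw [Int.card_Icc]
        have : (((⌊D (N - 1)⌋ + 1 - ⌊D 0⌋).toNat : ℤ) : ℝ) =
          ((⌊D (N - 1)⌋ + 1 - ⌊D 0⌋ : ℤ) : ℝ) := by rw [Int.toNat_of_nonneg (by omega)]
        push_cast at this
        exact this
      have e2 := le_add_mul_of_diff_le h' (i := 0) (j := N - 1) (by omega) (by omega)
      rw [Nat.cast_sub (by omega)] at e2
      push_cast at e2
      have e3 : 0 ≤ α * lam := by positivity
      rw [e1]
      linarith [Int.floor_le (D (N - 1)), Int.lt_floor_add_one (D 0)]
    have hB : 2 * (√lam / lam + 1) + 2 / √lam ≤ 6 / √lam := by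
      have e1 : √lam / lam = 1 / √lam := by
        rw [div_eq_div_iff hl.ne' hs.ne']; linarith
      have e2 : 1 ≤ 1 / √lam := by rw [le_div_iff₀ hs]; linarith
      have e3 : 2 / √lam = 2 * (1 / √lam) := by ring
      have e4 : 6 / √lam = 6 * (1 / √lam) := by ring
      rw [e1, e3, e4]
      linarith
    calc _ ≤ (α * lam * N + 2) * (6 / √lam) := by gcongr
      _ = _ := by
        field_simp
        rw [Real.sq_sqrt hl.le]
        ring
  · refine (norm_sum_expTwoPi_le_card _ _).trans ?_
    rw [Finset.card_range]
    have hs1 : 1 ≤ √lam := Real.one_le_sqrt.2 h1.le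
    have : (N : ℝ) * 1 ≤ N * (6 * α * √lam) := by gcongr; nlinarith
    have : 0 ≤ 12 / √lam := by positivity
    linarith

end SecondDifference

/-- Half of the second periodic Bernoulli function, up to an additive constant; it is a primitive
of `t ↦ Int.fract t - 1 / 2`. -/
noncomputable def sawtoothPrimitive (t : ℝ) : ℝ := (Int.fract t ^ 2 - Int.fract t) / 2

lemma hasSum_cos_sawtoothPrimitive (t : ℝ) :
    HasSum (fun n : ℕ => 1 / (n : ℝ) ^ 2 * Real.cos (2 * Real.pi * (n * t)))
      (Real.pi ^ 2 * (2 * sawtoothPrimitive t + 1 / 6)) := by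
  have h := hasSum_one_div_nat_pow_mul_cos one_ne_zero
    (x := Int.fract t) ⟨Int.fract_nonneg t, (Int.fract_lt_one t).le⟩
  convert h using 1
  · ext n
    have e : 2 * Real.pi * (n * t) =
        2 * Real.pi * n * Int.fract t + ((n * ⌊t⌋ : ℤ) : ℝ) * (2 * Real.pi) := by
      conv_lhs => rw [← Int.floor_add_fract t]
      push_cast
      ring
    rw [e, Real.cos_add_int_mul_two_pi, mul_one]
  · rw [sawtoothPrimitive]
    have : Polynomial.bernoulli 2 = Polynomial.X ^ 2 - Polynomial.X + Polynomial.C (1 / 6) := by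
      simp [Polynomial.bernoulli, Finset.sum_range_succ, Polynomial.monomial_zero_left]
      simp [← Polynomial.C_mul_X_pow_eq_monomial]
      ring
    simp only [mul_one, this]
    norm_num [Nat.factorial]
    ring

lemma fract_add_eq_or {t δ : ℝ} (h0 : 0 ≤ δ) (h1 : δ ≤ 1) :
    Int.fract (t + δ) = Int.fract t + δ ∨ Int.fract (t + δ) = Int.fract t + δ - 1 := by
  have a := Int.fract_nonneg t
  have b := Int.fract_lt_one t
  have e := Int.floor_add_fract t
  rcases lt_or_ge (Int.fract t + δ) 1 with h | h
  · exact Or.inl (Int.fract_eq_iff.2 ⟨by linarith, h, ⌊t⌋, by linarith⟩)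
  · exact Or.inr (Int.fract_eq_iff.2
      ⟨by linarith, by linarith, ⌊t⌋ + 1, by push_cast; linarith⟩)

lemma sawtoothPrimitive_add_sub_le {t δ : ℝ} (h0 : 0 ≤ δ) (h1 : δ ≤ 1) :
    sawtoothPrimitive (t + δ) - sawtoothPrimitive t ≤
      δ * (Int.fract t - 1 / 2) + δ ^ 2 / 2 := by
  have := Int.fract_nonneg (t + δ)
  rw [sawtoothPrimitive, sawtoothPrimitive]
  rcases fract_add_eq_or (t := t) h0 h1 with h | h <;> rw [h] at this ⊢ <;> nlinarith

lemma le_sawtoothPrimitive_sub_sub {t δ : ℝ} (h0 : 0 ≤ δ) (h1 : δ ≤ 1) :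
    δ * (Int.fract t - 1 / 2) - δ ^ 2 / 2 ≤
      sawtoothPrimitive t - sawtoothPrimitive (t - δ) := by
  have := Int.fract_lt_one (t - δ)
  have e : Int.fract t = Int.fract (t - δ + δ) := by rw [sub_add_cancel]
  rw [sawtoothPrimitive, sawtoothPrimitive]
  rcases fract_add_eq_or (t := t - δ) h0 h1 with h | h <;> rw [← e] at h
  · rw [h]; nlinarith
  · have : Int.fract (t - δ) = Int.fract t - δ + 1 := by linarith
    have := Int.fract_nonneg t
    nlinarith

lemma min_mul_sqrt_le_telescope {δ : ℝ} (hδ : 0 < δ) (m : ℕ) :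
    1 / ((m + 1 : ℕ) : ℝ) ^ 2 * (min 1 ((m + 1 : ℕ) * δ) * √(m + 1 : ℕ)) ≤
      8 * √δ * (√(δ * (m + 1 : ℕ)) / (1 + √(δ * (m + 1 : ℕ)))) -
      8 * √δ * (√(δ * m) / (1 + √(δ * m))) := by
  have hp2 : √((m + 1 : ℕ) : ℝ) ^ 2 = (m + 1 : ℕ) := Real.sq_sqrt (by positivity)
  have hd2 : √δ ^ 2 = δ := Real.sq_sqrt hδ.le
  have ht2 : √(δ * m) ^ 2 = δ * m := Real.sq_sqrt (by positivity)
  have hp : 0 < √((m + 1 : ℕ) : ℝ) := Real.sqrt_pos.2 (by positivity)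
  have hd : 0 < √δ := Real.sqrt_pos.2 hδ
  have ht : 0 ≤ √(δ * m) := Real.sqrt_nonneg _
  have hts : √(δ * m) ≤ √δ * √((m + 1 : ℕ) : ℝ) := by
    rw [← Real.sqrt_mul hδ.le]
    apply Real.sqrt_le_sqrt
    push_cast
    nlinarith
  rw [Real.sqrt_mul hδ.le ((m + 1 : ℕ) : ℝ), ← hp2]
  have hst2 : (√δ * √((m + 1 : ℕ) : ℝ)) ^ 2 - √(δ * m) ^ 2 = √δ ^ 2 := by
    rw [mul_pow, hp2, ht2, hd2]; push_cast; ring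
  rw [Real.sqrt_sq hp.le]
  nth_rewrite 1 [← hd2]
  generalize √((m + 1 : ℕ) : ℝ) = p at *
  generalize √(δ * m) = t at *
  generalize √δ = d at *
  set s := d * p with hs
  have hs0 : 0 < s := mul_pos hd hp
  have h1 : 8 * d * (s / (1 + s)) - 8 * d * (t / (1 + t)) =
      8 * d * (s - t) / ((1 + s) * (1 + t)) := by
    field_simp; ring
  have h2 : d ^ 2 / (2 * s) ≤ s - t := by
    rw [div_le_iff₀ (by positivity), ← hst2]
    nlinarith
  have h3 : 4 * d ^ 3 / (s * (1 + s) ^ 2) ≤ 8 * d * (s - t) / ((1 + s) * (1 + t)) := by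
    calc 4 * d ^ 3 / (s * (1 + s) ^ 2) = 8 * d * (d ^ 2 / (2 * s)) / ((1 + s) * (1 + s)) := by
          field_simp; norm_num
      _ ≤ _ := by gcongr
  rw [h1]
  refine le_trans ?_ h3
  have h4 : min 1 (p ^ 2 * d ^ 2) * (1 + s) ^ 2 ≤ 4 * s ^ 2 := by
    have e : p ^ 2 * d ^ 2 = s ^ 2 := by rw [hs]; ring
    rw [e]
    rcases le_total s 1 with h | h
    · calc min 1 (s ^ 2) * (1 + s) ^ 2 ≤ s ^ 2 * (1 + 1) ^ 2 := by
            gcongr; exact min_le_right _ _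
        _ = _ := by ring
    · calc min 1 (s ^ 2) * (1 + s) ^ 2 ≤ 1 * (s + s) ^ 2 := by
            gcongr; exact min_le_left _ _
        _ = _ := by ring
  calc 1 / (p ^ 2) ^ 2 * (min 1 (p ^ 2 * d ^ 2) * p)
      = (min 1 (p ^ 2 * d ^ 2) * (1 + s) ^ 2) * (1 / (p ^ 3 * (1 + s) ^ 2)) := by
        field_simp
    _ ≤ 4 * s ^ 2 * (1 / (p ^ 3 * (1 + s) ^ 2)) := by gcongr
    _ = 4 * d ^ 3 / (s * (1 + s) ^ 2) := by
        rw [hs]; field_simp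

lemma norm_expTwoPi_sub_one_le {s δ : ℝ} (h : |s| ≤ δ) (n : ℕ) :
    ‖expTwoPi (n * s) - 1‖ ≤ 2 * Real.pi * min 1 (n * δ) := by
  have hp := Real.two_le_pi
  rw [mul_min_of_nonneg _ _ (by positivity), le_min_iff]
  constructor
  · refine (norm_sub_le _ _).trans ?_
    rw [norm_expTwoPi, norm_one]
    linarith
  · rw [expTwoPi, mul_comm _ Complex.I]
    refine (Real.norm_exp_I_mul_ofReal_sub_one_le).trans ?_
    rw [Real.norm_eq_abs, abs_mul (2 * Real.pi), abs_mul (n : ℝ), abs_of_pos (by positivity : 0 < 2 * Real.pi),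
      Nat.abs_cast]
    gcongr

lemma re_expTwoPi (t : ℝ) : (expTwoPi t).re = Real.cos (2 * Real.pi * t) := by
  rw [expTwoPi, Complex.exp_ofReal_mul_I_re]

lemma abs_sum_sawtoothPrimitive_sub_le {ι : Type*} (A : Finset ι) (t : ι → ℝ) {B s δ : ℝ}
    (hB : ∀ n : ℕ, 0 < n → ‖∑ a ∈ A, expTwoPi (n * t a)‖ ≤ B * √n)
    (hδ : 0 < δ) (h : |s| ≤ δ) :
    |∑ a ∈ A, (sawtoothPrimitive (t a + s) - sawtoothPrimitive (t a))| ≤ 8 * B * √δ := by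
  have hB0 : 0 ≤ B := by simpa using (norm_nonneg _).trans (hB 1 one_pos)
  have hsum := hasSum_sum (fun a (_ : a ∈ A) =>
    (hasSum_cos_sawtoothPrimitive (t a + s)).sub (hasSum_cos_sawtoothPrimitive (t a)))
  set f : ℕ → ℝ := fun n => ∑ a ∈ A, (1 / (n : ℝ) ^ 2 * Real.cos (2 * Real.pi * (n * (t a + s))) -
    1 / (n : ℝ) ^ 2 * Real.cos (2 * Real.pi * (n * t a))) with hf
  have hfn : ∀ n : ℕ, 0 < n →
      |f n| ≤ 2 * Real.pi * B * (1 / (n : ℝ) ^ 2 * (min 1 (n * δ) * √n)) := by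
    intro n hn
    have e : f n =
        1 / (n : ℝ) ^ 2 * ((expTwoPi (n * s) - 1) * ∑ a ∈ A, expTwoPi (n * t a)).re := by
      rw [Finset.mul_sum, Complex.re_sum, Finset.mul_sum]
      refine Finset.sum_congr rfl fun a _ => ?_
      rw [sub_mul, one_mul, ← expTwoPi_add, Complex.sub_re, re_expTwoPi, re_expTwoPi, ← mul_sub]
      congr 4
      ring
    rw [e, abs_mul, abs_of_nonneg (by positivity : 0 ≤ 1 / (n : ℝ) ^ 2)]
    have h1 : |((expTwoPi (n * s) - 1) * ∑ a ∈ A, expTwoPi (n * t a)).re| ≤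
        (2 * Real.pi * min 1 (n * δ)) * (B * √n) := by
      refine (Complex.abs_re_le_norm _).trans ?_
      rw [norm_mul]
      have : 0 ≤ min 1 (n * δ) := by positivity
      gcongr
      · exact norm_expTwoPi_sub_one_le h n
      · exact hB n hn
    calc _ ≤ 1 / (n : ℝ) ^ 2 * ((2 * Real.pi * min 1 (n * δ)) * (B * √n)) := by gcongr
      _ = _ := by ring
  have hpart : ∀ K : ℕ, |∑ n ∈ Finset.range (K + 1), f n| ≤
      2 * Real.pi * B * (8 * √δ * (√(δ * K) / (1 + √(δ * K)))) := by
    intro K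
    induction K with
    | zero => simp [hf]
    | succ K ih =>
      rw [Finset.sum_range_succ]
      refine (abs_add_le _ _).trans ?_
      have h1 := hfn (K + 1) (by omega)
      have h2 := mul_le_mul_of_nonneg_left (min_mul_sqrt_le_telescope hδ K)
        (by positivity : 0 ≤ 2 * Real.pi * B)
      linarith
  have hlim := ((hsum.tendsto_sum_nat).comp (Filter.tendsto_add_atTop_nat 1)).abs
  have hle := le_of_tendsto hlim (b := 2 * Real.pi * B * (8 * √δ * 1)) (Filter.Eventually.of_forall
    fun K => (hpart K).trans (by
      gcongr
      rw [div_le_one (by positivity)]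
      linarith))
  have e : ∑ a ∈ A, (Real.pi ^ 2 * (2 * sawtoothPrimitive (t a + s) + 1 / 6) -
      Real.pi ^ 2 * (2 * sawtoothPrimitive (t a) + 1 / 6)) =
      2 * Real.pi ^ 2 * ∑ a ∈ A, (sawtoothPrimitive (t a + s) - sawtoothPrimitive (t a)) := by
    rw [Finset.mul_sum]
    exact Finset.sum_congr rfl fun a _ => by ring
  rw [e, abs_mul, abs_of_pos (by positivity)] at hle
  have hp := Real.two_le_pi
  have h3 : 0 ≤ 8 * B * √δ := by positivity
  refine le_of_mul_le_mul_left (hle.trans ?_) (by positivity : 0 < 2 * Real.pi ^ 2)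
  calc 2 * Real.pi * B * (8 * √δ * 1) = 2 * Real.pi * 1 * (8 * B * √δ) := by ring
    _ ≤ 2 * Real.pi * Real.pi * (8 * B * √δ) := by gcongr; linarith
    _ = _ := by ring

lemma abs_sum_fract_sub_half_le {ι : Type*} (A : Finset ι) (t : ι → ℝ) {B δ : ℝ}
    (hB : ∀ n : ℕ, 0 < n → ‖∑ a ∈ A, expTwoPi (n * t a)‖ ≤ B * √n)
    (hδ : 0 < δ) (hδ1 : δ ≤ 1) :
    |∑ a ∈ A, (Int.fract (t a) - 1 / 2)| ≤ 8 * B / √δ + A.card * δ / 2 := by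
  have hs : √δ ^ 2 = δ := Real.sq_sqrt hδ.le
  have hs0 : 0 < √δ := Real.sqrt_pos.2 hδ
  have e1 := abs_le.1 (abs_sum_sawtoothPrimitive_sub_le A t hB hδ (abs_of_pos hδ).le)
  have e2 := abs_le.1 (abs_sum_sawtoothPrimitive_sub_le A t (s := -δ) hB hδ
    (by rw [abs_neg, abs_of_pos hδ]))
  have f1 := Finset.sum_le_sum fun a (_ : a ∈ A) =>
    sawtoothPrimitive_add_sub_le (t := t a) hδ.le hδ1
  have f2 := Finset.sum_le_sum fun a (_ : a ∈ A) =>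
    le_sawtoothPrimitive_sub_sub (t := t a) hδ.le hδ1
  rw [Finset.sum_add_distrib, ← Finset.mul_sum, Finset.sum_const, nsmul_eq_mul] at f1
  rw [Finset.sum_sub_distrib, ← Finset.mul_sum, Finset.sum_const, nsmul_eq_mul] at f2
  simp only [← sub_eq_add_neg] at e2
  have e3 : ∑ a ∈ A, (sawtoothPrimitive (t a - δ) - sawtoothPrimitive (t a)) =
      -∑ a ∈ A, (sawtoothPrimitive (t a) - sawtoothPrimitive (t a - δ)) := by
    rw [← Finset.sum_neg_distrib]
    exact Finset.sum_congr rfl fun a _ => by ring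
  rw [e3] at e2
  have e4 : 8 * B * √δ = δ * (8 * B / √δ) := by
    rw [← hs, Real.sqrt_sq hs0.le]; field_simp
  rw [e4] at e1 e2
  rw [abs_le]
  constructor <;> refine le_of_mul_le_mul_left ?_ hδ <;> nlinarith

lemma sqrt_sub_sq_expansion {R x y : ℝ} (hR : 0 < R) (hx : x ^ 2 ≤ R / 2) (hy : y ^ 2 ≤ R) :
    ∃ K, √(R - y ^ 2) = √(R - x ^ 2) - x * (y - x) / √(R - x ^ 2) - K * (y - x) ^ 2 ∧
      |K| ≤ 8 / √R ∧ (0 ≤ x * (x + y) → 1 / (2 * √R) ≤ K) := by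
  have hr : 0 < √R := Real.sqrt_pos.2 hR
  have hr2 : √R ^ 2 = R := Real.sq_sqrt hR.le
  have hu : 0 < √(R - x ^ 2) := Real.sqrt_pos.2 (by linarith)
  have hu2 : √(R - x ^ 2) ^ 2 = R - x ^ 2 := Real.sq_sqrt (by linarith)
  have hv : 0 ≤ √(R - y ^ 2) := Real.sqrt_nonneg _
  have hv2 : √(R - y ^ 2) ^ 2 = R - y ^ 2 := Real.sq_sqrt (by linarith)
  generalize √(R - x ^ 2) = u at *
  generalize √(R - y ^ 2) = v at *
  generalize √R = r at *
  subst hr2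
  have hur : u ≤ r := abs_le_of_sq_le_sq' (by nlinarith) hr.le |>.2
  have hvr : v ≤ r := abs_le_of_sq_le_sq' (by nlinarith) hr.le |>.2
  have hxr := abs_le_of_sq_le_sq (by nlinarith : x ^ 2 ≤ r ^ 2) hr.le
  have hyr := abs_le_of_sq_le_sq hy hr.le
  have hru : 2 * r ≤ 3 * u := abs_le_of_sq_le_sq' (by nlinarith) (by positivity) |>.2
  refine ⟨(x * (x + y) / (u + v) + u) / (u * (u + v)), ?_, ?_, ?_⟩
  · have h1 : x ^ 2 = r ^ 2 - u ^ 2 := by linarith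
    have h2 : y ^ 2 = r ^ 2 - v ^ 2 := by linarith
    have h3 : (v - u) * (u + v) = (x - y) * (x + y) := by linarith
    field_simp
    linear_combination (u * (u + v) + x * (y - x)) * h3
  · have h1 : |x * (x + y) / (u + v)| ≤ 3 * r := by
      rw [abs_div, abs_mul, abs_of_pos (by positivity : 0 < u + v), div_le_iff₀ (by positivity)]
      have h2 : |x + y| ≤ 2 * r := (abs_add_le _ _).trans (by linarith)
      calc |x| * |x + y| ≤ r * (2 * r) := by gcongr
        _ ≤ 3 * r * (u + v) := by nlinarith
    rw [abs_div, abs_of_pos (by positivity : 0 < u * (u + v)), div_le_div_iff₀ (by positivity) hr]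
    have h2 : |x * (x + y) / (u + v) + u| ≤ 4 * r := by
      refine (abs_add_le _ _).trans ?_
      rw [abs_of_pos hu]; linarith
    calc _ ≤ 4 * r * r := by gcongr
      _ ≤ 8 * (u * (u + v)) := by nlinarith
  · intro h
    have h1 : 0 ≤ x * (x + y) / (u + v) := by positivity
    calc 1 / (2 * r) ≤ 1 / (u + v) := by gcongr; linarith
      _ = u / (u * (u + v)) := by field_simp
      _ ≤ _ := by gcongr; linarith

lemma second_diff_sqrt_bounds {R : ℝ} (hR : 0 < R) {a : ℤ} (ha : (a : ℝ) ^ 2 ≤ R / 2)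
    (h1 : ((a : ℝ) + 1) ^ 2 ≤ R) (h2 : ((a : ℝ) - 1) ^ 2 ≤ R) :
    1 / √R ≤ 2 * √(R - (a : ℝ) ^ 2) - √(R - ((a : ℝ) + 1) ^ 2) - √(R - ((a : ℝ) - 1) ^ 2) ∧
    2 * √(R - (a : ℝ) ^ 2) - √(R - ((a : ℝ) + 1) ^ 2) - √(R - ((a : ℝ) - 1) ^ 2) ≤
      16 * (1 / √R) := by
  obtain ⟨K, e1, b1, c1⟩ := sqrt_sub_sq_expansion hR ha h1
  obtain ⟨K', e2, b2, c2⟩ := sqrt_sub_sq_expansion hR ha h2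
  have i1 : 0 ≤ a * (a + (a + 1)) := by
    rcases le_or_gt 0 a with h | h <;> nlinarith
  have i2 : 0 ≤ a * (a + (a - 1)) := by
    rcases le_or_gt a 0 with h | h <;> nlinarith
  have d1 := c1 (by exact_mod_cast i1)
  have d2 := c2 (by exact_mod_cast i2)
  have e : 2 * √(R - (a : ℝ) ^ 2) - √(R - ((a : ℝ) + 1) ^ 2) - √(R - ((a : ℝ) - 1) ^ 2) =
      K + K' := by
    rw [e1, e2]; ring
  have e3 : 1 / (2 * √R) = 1 / √R / 2 := by field_simp
  have e4 : 8 / √R = 8 * (1 / √R) := by ring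
  rw [e]
  rw [e3] at d1 d2
  rw [e4] at b1 b2
  constructor
  · linarith
  · linarith [(abs_le.1 b1).2, (abs_le.1 b2).2]

lemma expTwoPi_neg (x : ℝ) : expTwoPi (-x) = (starRingEnd ℂ) (expTwoPi x) := by
  rw [expTwoPi, expTwoPi, ← Complex.exp_conj, map_mul, Complex.conj_ofReal, Complex.conj_I]
  push_cast
  ring_nf

lemma norm_sum_expTwoPi_neg {ι : Type*} (s : Finset ι) (x : ι → ℝ) :
    ‖∑ n ∈ s, expTwoPi (-x n)‖ = ‖∑ n ∈ s, expTwoPi (x n)‖ := by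
  simp only [expTwoPi_neg]
  rw [← map_sum, RCLike.norm_conj]

lemma norm_sum_expTwoPi_sqrt_le {R : ℝ} (hR : 1 ≤ R) {M : ℕ} (hM : (M : ℝ) ^ 2 ≤ R / 2) {h : ℕ}
    (hh : 0 < h) :
    ‖∑ j ∈ Finset.range (2 * M + 1), expTwoPi (h * √(R - ((j : ℝ) - M) ^ 2))‖ ≤
      205 * √(√R) * √h := by
  have hR0 : 0 < R := by linarith
  have hr : 1 ≤ √R := Real.one_le_sqrt.2 hR
  have hr2 : √R ^ 2 = R := Real.sq_sqrt hR0.le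
  have hh1 : (1 : ℝ) ≤ h := by exact_mod_cast hh
  have hMr : (M : ℝ) ≤ √R := abs_le_of_sq_le_sq' (by linarith) (by linarith) |>.2
  rw [← norm_sum_expTwoPi_neg, Finset.sum_range_succ]
  refine (norm_add_le _ _).trans ?_
  rw [norm_expTwoPi]
  have key : ∀ n, n + 1 < 2 * M →
      (1 / √R ≤ 2 * √(R - (((n + 1 : ℕ) : ℝ) - M) ^ 2) - √(R - (((n + 1 + 1 : ℕ) : ℝ) - M) ^ 2)
        - √(R - ((n : ℝ) - M) ^ 2)) ∧
      (2 * √(R - (((n + 1 : ℕ) : ℝ) - M) ^ 2) - √(R - (((n + 1 + 1 : ℕ) : ℝ) - M) ^ 2)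
        - √(R - ((n : ℝ) - M) ^ 2) ≤ 16 * (1 / √R)) := by
    intro n hn
    have hn' : (n : ℝ) + 2 ≤ 2 * M := by exact_mod_cast hn
    have hn0 : (0 : ℝ) ≤ n := by positivity
    have := second_diff_sqrt_bounds hR0 (a := n + 1 - M) (by push_cast; nlinarith)
      (by push_cast; nlinarith) (by push_cast; nlinarith)
    push_cast at this ⊢
    have e1 : (n : ℝ) + 1 - M + 1 = n + 1 + 1 - M := by ring
    have e2 : (n : ℝ) + 1 - M - 1 = n - M := by ring
    rwa [e1, e2] at this
  have hvdc := norm_sum_expTwoPi_le_of_second_diff (N := 2 * M) (lam := h / √R) (α := 16)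
    (fun n => -(h * √(R - ((n : ℝ) - M) ^ 2))) (fun n => rfl) (by positivity) (by norm_num)
    (by
      intro n hn
      have := mul_le_mul_of_nonneg_left (key n hn).1 (by linarith : (0 : ℝ) ≤ h)
      have e : (h : ℝ) / √R = h * (1 / √R) := by ring
      simp only [e]
      linarith)
    (by
      intro n hn
      have := mul_le_mul_of_nonneg_left (key n hn).2 (by linarith : (0 : ℝ) ≤ h)
      have e : (h : ℝ) / √R = h * (1 / √R) := by ring
      simp only [e]
      linarith)
  have hq : 1 ≤ √(√R) := Real.one_le_sqrt.2 hr
  have hq2 : √(√R) ^ 2 = √R := Real.sq_sqrt (by linarith)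
  have hg : 1 ≤ √(h : ℝ) := Real.one_le_sqrt.2 hh1
  rw [Real.sqrt_div (by linarith)] at hvdc
  push_cast at hvdc
  have t1 : 6 * 16 * (2 * M) * (√(h : ℝ) / √(√R)) ≤ 192 * (√(√R) * √h) := by
    calc _ ≤ 6 * 16 * (2 * √(√R) ^ 2) * (√(h : ℝ) / √(√R)) := by rw [hq2]; gcongr
      _ = _ := by field_simp; norm_num
  have t2 : 12 / (√(h : ℝ) / √(√R)) ≤ 12 * (√(√R) * √h) := by
    rw [div_div_eq_mul_div, div_le_iff₀ (by positivity)]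
    have : 1 ≤ √(h : ℝ) * √(h : ℝ) := by nlinarith
    nlinarith
  have t3 : 1 ≤ √(√R) * √h := by nlinarith
  linarith

lemma abs_sum_fract_sqrt_le {R : ℝ} (hR : 1 ≤ R) {M : ℕ} (hM : (M : ℝ) ^ 2 ≤ R / 2) :
    |∑ j ∈ Finset.range (2 * M + 1), (Int.fract √(R - ((j : ℝ) - M) ^ 2) - 1 / 2)| ≤
      1642 * R ^ ((1 : ℝ) / 3) := by
  have hR0 : 0 < R := by linarith
  set c := R ^ ((1 : ℝ) / 6) with hc
  have hc1 : 1 ≤ c := Real.one_le_rpow hR (by norm_num)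
  have hc0 : 0 < c := by linarith
  have hc6 : c ^ 6 = R := by
    rw [hc, ← Real.rpow_natCast, ← Real.rpow_mul hR0.le]; norm_num
  have hc2 : R ^ ((1 : ℝ) / 3) = c ^ 2 := by
    rw [hc, ← Real.rpow_natCast, ← Real.rpow_mul hR0.le]; norm_num
  have hr : √R = c ^ 3 := by
    rw [← hc6, show c ^ 6 = (c ^ 3) ^ 2 by ring, Real.sqrt_sq (by positivity)]
  have hMr : (M : ℝ) ≤ c ^ 3 := by
    rw [← hr]; exact Real.le_sqrt_of_sq_le (by linarith)
  have h := abs_sum_fract_sub_half_le (Finset.range (2 * M + 1))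
    (fun j => √(R - ((j : ℝ) - M) ^ 2)) (δ := 1 / c)
    (fun n hn => norm_sum_expTwoPi_sqrt_le hR hM hn) (by positivity)
    (by rw [div_le_one hc0]; exact hc1)
  refine h.trans ?_
  have hs : √(√R) = √c * c := by
    rw [hr, show c ^ 3 = c * c ^ 2 by ring, Real.sqrt_mul hc0.le, Real.sqrt_sq hc0.le]
  have hsc : √c ^ 2 = c := Real.sq_sqrt hc0.le
  rw [hs, hc2, Finset.card_range, Real.sqrt_div zero_le_one, Real.sqrt_one]
  have e1 : 8 * (205 * (√c * c)) / (1 / √c) = 1640 * c ^ 2 := by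
    rw [div_div_eq_mul_div, div_one]
    linear_combination 1640 * c * hsc
  have e2 : ((2 * M + 1 : ℕ) : ℝ) * (1 / c) / 2 ≤ 2 * c ^ 2 := by
    push_cast
    rw [mul_one_div, div_div, div_le_iff₀ (by positivity)]
    have : 1 ≤ c ^ 3 := one_le_pow₀ hc1
    nlinarith
  linarith

/-- A primitive of `x ↦ √(R - x ^ 2)`. -/
noncomputable def discPrimitive (R x : ℝ) : ℝ :=
  (x * √(R - x ^ 2) + R * Real.arcsin (x / √R)) / 2

lemma discPrimitive_neg (R x : ℝ) : discPrimitive R (-x) = -discPrimitive R x := by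
  rw [discPrimitive, discPrimitive, neg_div, Real.arcsin_neg, neg_sq]
  ring

lemma hasDerivAt_discPrimitive {R x : ℝ} (h : x ^ 2 < R) :
    HasDerivAt (discPrimitive R) √(R - x ^ 2) x := by
  have hR : 0 < R := (sq_nonneg x).trans_lt h
  have hr : 0 < √R := Real.sqrt_pos.2 hR
  have hr2 : √R ^ 2 = R := Real.sq_sqrt hR.le
  have hu : 0 < √(R - x ^ 2) := Real.sqrt_pos.2 (by linarith)
  have hu2 : √(R - x ^ 2) ^ 2 = R - x ^ 2 := Real.sq_sqrt (by linarith)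
  have hlt : (x / √R) ^ 2 < 1 := by
    rw [div_pow, hr2, div_lt_one hR]; exact h
  have hs := (sq_lt_one_iff_abs_lt_one _).1 hlt
  rw [abs_lt] at hs
  have h1 : HasDerivAt (fun y : ℝ => R - y ^ 2) (-(2 * x)) x := by
    simpa using (hasDerivAt_pow 2 x).const_sub R
  have h2 := (hasDerivAt_id x).mul (h1.sqrt (by linarith : R - x ^ 2 ≠ 0))
  have h3 := ((Real.hasDerivAt_arcsin hs.1.ne' hs.2.ne).comp x
    ((hasDerivAt_id x).div_const √R)).const_mul R
  have h4 := (h2.add h3).div_const 2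
  refine h4.congr_deriv ?_
  have e : √(1 - (x / √R) ^ 2) = √(R - x ^ 2) / √R := by
    rw [← Real.sqrt_div (by linarith), div_pow, hr2]
    congr 1
    field_simp
  simp only [id, e]
  field_simp
  nlinarith

lemma discPrimitive_expansion {R x y : ℝ} (hR : 0 < R) (hx : x ^ 2 ≤ R / 2) (hy : y ^ 2 < R) :
    |discPrimitive R y - discPrimitive R x - √(R - x ^ 2) * (y - x) +
      x / (2 * √(R - x ^ 2)) * (y - x) ^ 2| ≤ 8 / √R * |y - x| ^ 3 := by
  set Q : ℝ → ℝ := fun z => discPrimitive R z - √(R - x ^ 2) * (z - x) +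
      x / (2 * √(R - x ^ 2)) * (z - x) ^ 2
  have hu : 0 < √(R - x ^ 2) := Real.sqrt_pos.2 (by linarith)
  have hz : ∀ z ∈ Set.uIcc x y, z ^ 2 < R := by
    intro z hz
    have hxR : x ^ 2 < R := by linarith
    rcases Set.mem_uIcc.1 hz with h | h
    · rcases le_or_gt 0 z with h0 | h0 <;> nlinarith
    · rcases le_or_gt 0 z with h0 | h0 <;> nlinarith
  have hd : ∀ z ∈ Set.uIcc x y, HasDerivWithinAt Q (√(R - z ^ 2) - √(R - x ^ 2) +
      x * (z - x) / √(R - x ^ 2)) (Set.uIcc x y) z := by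
    intro z hzm
    have h1 := hasDerivAt_discPrimitive (hz z hzm)
    have h2 : HasDerivAt (fun z => z - x) 1 z := (hasDerivAt_id z).sub_const x
    have h3 := (h1.sub (h2.const_mul √(R - x ^ 2))).add
      ((h2.pow 2).const_mul (x / (2 * √(R - x ^ 2))))
    refine (h3.congr_deriv ?_).hasDerivWithinAt
    simp
    field_simp
  have hb : ∀ z ∈ Set.uIcc x y, ‖√(R - z ^ 2) - √(R - x ^ 2) +
      x * (z - x) / √(R - x ^ 2)‖ ≤ 8 / √R * |y - x| ^ 2 := by
    intro z hzm
    obtain ⟨K, e, b, -⟩ := sqrt_sub_sq_expansion hR hx (hz z hzm).le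
    have e' : √(R - z ^ 2) - √(R - x ^ 2) + x * (z - x) / √(R - x ^ 2) = -(K * (z - x) ^ 2) := by
      rw [e]; ring
    rw [e', norm_neg, norm_mul, Real.norm_eq_abs, norm_pow, Real.norm_eq_abs]
    have : |z - x| ≤ |y - x| := Set.abs_sub_left_of_mem_uIcc hzm
    gcongr
  have := Convex.norm_image_sub_le_of_norm_hasDerivWithin_le hd hb (convex_uIcc x y)
    Set.left_mem_uIcc Set.right_mem_uIcc
  rw [Real.norm_eq_abs, Real.norm_eq_abs] at this
  have e : Q y - Q x = discPrimitive R y - discPrimitive R x - √(R - x ^ 2) * (y - x) +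
      x / (2 * √(R - x ^ 2)) * (y - x) ^ 2 := by
    simp only [Q]; ring
  rw [e] at this
  refine this.trans (le_of_eq ?_)
  ring

lemma abs_discPrimitive_midpoint_le {R x : ℝ} (hR : 0 < R) (hx : x ^ 2 ≤ R / 2)
    (h1 : (x + 1 / 2) ^ 2 < R) (h2 : (x - 1 / 2) ^ 2 < R) :
    |discPrimitive R (x + 1 / 2) - discPrimitive R (x - 1 / 2) - √(R - x ^ 2)| ≤ 2 / √R := by
  have a := abs_le.1 (discPrimitive_expansion hR hx h1)
  have b := abs_le.1 (discPrimitive_expansion hR hx h2)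
  rw [show x + 1 / 2 - x = 1 / 2 by ring] at a
  rw [show x - 1 / 2 - x = -(1 / 2) by ring] at b
  rw [abs_neg] at b
  rw [abs_of_pos (by norm_num : (0 : ℝ) < 1 / 2)] at a b
  have e : 8 / √R * (1 / 2) ^ 3 = 2 / √R / 2 := by ring
  rw [e] at a b
  rw [abs_le]
  constructor <;> linarith [a.1, a.2, b.1, b.2]

lemma abs_sum_sqrt_sub_discPrimitive_le {R : ℝ} (hR : 0 < R) {M : ℕ} (hM : (M : ℝ) ^ 2 ≤ R / 2)
    (hM' : ((M : ℝ) + 1 / 2) ^ 2 < R) :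
    |∑ j ∈ Finset.range (2 * M + 1), √(R - ((j : ℝ) - M) ^ 2) -
      2 * discPrimitive R (M + 1 / 2)| ≤ (2 * M + 1) * (2 / √R) := by
  have htel := Finset.sum_range_sub (fun j : ℕ => discPrimitive R ((j : ℝ) - M - 1 / 2))
    (2 * M + 1)
  have e1 : discPrimitive R (((2 * M + 1 : ℕ) : ℝ) - M - 1 / 2) = discPrimitive R (M + 1 / 2) := by
    congr 1; push_cast; ring
  have e2 : discPrimitive R (((0 : ℕ) : ℝ) - M - 1 / 2) = -discPrimitive R (M + 1 / 2) := by
    rw [← discPrimitive_neg]; congr 1; push_cast; ring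
  rw [e1, e2] at htel
  rw [show 2 * discPrimitive R (M + 1 / 2) =
    discPrimitive R (M + 1 / 2) - -discPrimitive R (M + 1 / 2) by ring, ← htel,
    ← Finset.sum_sub_distrib]
  refine (Finset.abs_sum_le_sum_abs _ _).trans ?_
  have : ∀ j ∈ Finset.range (2 * M + 1), |√(R - ((j : ℝ) - M) ^ 2) -
      (discPrimitive R (((j + 1 : ℕ) : ℝ) - M - 1 / 2) - discPrimitive R ((j : ℝ) - M - 1 / 2))| ≤
      2 / √R := by
    intro j hj
    have hj' : (j : ℝ) + 1 ≤ 2 * M + 1 := by exact_mod_cast Finset.mem_range.1 hj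
    have hj0 : (0 : ℝ) ≤ j := by positivity
    have h := abs_discPrimitive_midpoint_le (x := (j : ℝ) - M) hR (by nlinarith) (by nlinarith)
      (by nlinarith)
    rw [abs_sub_comm, show ((j + 1 : ℕ) : ℝ) - M - 1 / 2 = j - M + 1 / 2 by push_cast; ring]
    exact h
  refine (Finset.sum_le_card_nsmul _ _ _ this).trans (le_of_eq ?_)
  rw [Finset.card_range, nsmul_eq_mul]
  push_cast
  rfl

lemma discPrimitive_sqrt_half {R : ℝ} (hR : 0 < R) :
    discPrimitive R √(R / 2) = R / 4 + Real.pi * R / 8 := by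
  have h1 : R - √(R / 2) ^ 2 = R / 2 := by rw [Real.sq_sqrt (by positivity)]; ring
  have h2 : √(R / 2) / √R = Real.sin (Real.pi / 4) := by
    rw [Real.sin_pi_div_four, ← Real.sqrt_div (by positivity)]
    rw [Real.sqrt_eq_iff_mul_self_eq (by positivity) (by positivity)]
    have := Real.mul_self_sqrt (by norm_num : (0 : ℝ) ≤ 2)
    field_simp
    nlinarith
  rw [discPrimitive, h1, h2, Real.arcsin_sin (by linarith [Real.pi_pos]) (by linarith [Real.pi_pos]),
    Real.mul_self_sqrt (by positivity)]
  ring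

lemma abs_four_mul_sum_sqrt_sub_le {R : ℝ} (hR : 4 ≤ R) :
    |4 * ∑ j ∈ Finset.range (2 * ⌊√(R / 2)⌋₊ + 1), √(R - ((j : ℝ) - ⌊√(R / 2)⌋₊) ^ 2) -
      (2 * ⌊√(R / 2)⌋₊ + 1) ^ 2 - Real.pi * R| ≤ 34 := by
  have hR0 : 0 < R := by linarith
  have hL2 : √(R / 2) ^ 2 = R / 2 := Real.sq_sqrt (by positivity)
  have hL0 : 0 < √(R / 2) := Real.sqrt_pos.2 (by positivity)
  have hML := Nat.floor_le hL0.le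
  have hLM := Nat.lt_floor_add_one √(R / 2)
  have hP := discPrimitive_sqrt_half hR0
  generalize ⌊√(R / 2)⌋₊ = M at *
  have hu : √(R - √(R / 2) ^ 2) = √(R / 2) := by rw [hL2]; congr 1; ring
  have hr : 2 ≤ √R := Real.le_sqrt_of_sq_le (by linarith)
  have hMr : (M : ℝ) ≤ √R := hML.trans (Real.sqrt_le_sqrt (by linarith))
  have hM0 : (0 : ℝ) ≤ M := by positivity
  have hL1 : 1.4 ≤ √(R / 2) := Real.le_sqrt_of_sq_le (by norm_num; linarith)
  have hM' : ((M : ℝ) + 1 / 2) ^ 2 < R := by nlinarith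
  have h1 := abs_le.1 (abs_sum_sqrt_sub_discPrimitive_le hR0 (by nlinarith) hM')
  have h2 := abs_le.1 (discPrimitive_expansion hR0 hL2.le hM')
  rw [hu, hP] at h2
  generalize √(R / 2) = L at *
  obtain ⟨s, hs⟩ : ∃ s, s = (M : ℝ) + 1 / 2 - L := ⟨_, rfl⟩
  rw [← hs] at h2
  have hs1 : |s| ≤ 1 / 2 := by rw [abs_le]; constructor <;> linarith
  have hs2 : s ^ 2 ≤ 1 / 4 := by nlinarith [abs_le.1 hs1]
  have e1 : L / (2 * L) = 1 / 2 := by field_simp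
  have e2 : 8 / √R * |s| ^ 3 ≤ 1 / 2 := by
    calc 8 / √R * |s| ^ 3 ≤ 8 / 2 * (1 / 2) ^ 3 := by gcongr
      _ = _ := by norm_num
  have e3 : (2 * M + 1) * (2 / √R) ≤ 6 := by
    rw [mul_div_assoc', div_le_iff₀ (by linarith)]
    linarith
  rw [e1] at h2
  have e4 : (2 * (M : ℝ) + 1) ^ 2 = 2 * R + 8 * (L * s) + 4 * s ^ 2 := by
    have : (M : ℝ) = L + s - 1 / 2 := by linarith
    rw [this]
    linear_combination 4 * hL2
  rw [e4, abs_le]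
  have := sq_nonneg s
  constructor <;> linarith [h1.1, h1.2, h2.1, h2.2]

lemma sum_Icc_neg_eq_sum_range (M : ℕ) (g : ℤ → ℝ) :
    ∑ a ∈ Finset.Icc (-(M : ℤ)) M, g a = ∑ j ∈ Finset.range (2 * M + 1), g (j - M) := by
  refine Finset.sum_nbij' (fun a => (a + M).toNat) (fun j => (j : ℤ) - M) ?_ ?_ ?_ ?_ ?_
  · intro a ha
    rw [Finset.mem_Icc] at ha
    rw [Finset.mem_range]
    omega
  · intro j hj
    rw [Finset.mem_range] at hj
    rw [Finset.mem_Icc]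
    omega
  · intro a ha
    rw [Finset.mem_Icc] at ha
    omega
  · intro j _
    omega
  · intro a ha
    rw [Finset.mem_Icc] at ha
    congr 1
    omega

lemma mem_Icc_neg_floor_sqrt_iff {S : ℝ} (hS : 0 ≤ S) (b : ℤ) :
    b ∈ Finset.Icc (-⌊√S⌋) ⌊√S⌋ ↔ (b : ℝ) ^ 2 ≤ S := by
  rw [Finset.mem_Icc, ← abs_le, Int.le_floor, Int.cast_abs, ← Real.sqrt_sq_eq_abs,
    Real.sqrt_le_sqrt_iff hS]

lemma card_Icc_neg_floor_sqrt (S : ℝ) :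
    ((Finset.Icc (-⌊√S⌋) ⌊√S⌋).card : ℝ) = 2 * √S - 2 * (Int.fract √S - 1 / 2) := by
  have h : 0 ≤ ⌊√S⌋ := Int.floor_nonneg.2 (Real.sqrt_nonneg S)
  have h2 : (((Finset.Icc (-⌊√S⌋) ⌊√S⌋).card : ℤ) : ℝ) = ((2 * ⌊√S⌋ + 1 : ℤ) : ℝ) := by
    rw [Int.card_Icc, Int.toNat_of_nonneg (by omega)]
    congr 1
    ring
  have h3 := Int.floor_add_fract √S
  push_cast at h2
  linarith

/-- The lattice points of the closed disc of squared radius `R`. -/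
noncomputable def discPoints (R : ℝ) : Finset (ℤ × ℤ) :=
  {p ∈ Finset.Icc (-⌊√R⌋) ⌊√R⌋ ×ˢ Finset.Icc (-⌊√R⌋) ⌊√R⌋ | (p.1 : ℝ) ^ 2 + (p.2 : ℝ) ^ 2 ≤ R}

lemma mem_discPoints {R : ℝ} (hR : 0 ≤ R) (p : ℤ × ℤ) :
    p ∈ discPoints R ↔ (p.1 : ℝ) ^ 2 + (p.2 : ℝ) ^ 2 ≤ R := by
  rw [discPoints, Finset.mem_filter, Finset.mem_product, mem_Icc_neg_floor_sqrt_iff hR,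
    mem_Icc_neg_floor_sqrt_iff hR, and_iff_right_iff_imp]
  intro h
  constructor <;> nlinarith [sq_nonneg (p.1 : ℝ), sq_nonneg (p.2 : ℝ)]

lemma ncard_eq_card_discPoints {R : ℝ} (hR : 0 ≤ R) :
    {p : ℤ × ℤ | (p.1 : ℝ) ^ 2 + (p.2 : ℝ) ^ 2 ≤ R}.ncard = (discPoints R).card := by
  rw [← Set.ncard_coe_finset]
  congr 1
  ext p
  rw [Finset.mem_coe, mem_discPoints hR, Set.mem_ofPred_eq]

lemma card_discPoints_vertical_strip {R : ℝ} (hR : 0 ≤ R) {M : ℕ} (hM : (M : ℝ) ^ 2 ≤ R) :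
    ((discPoints R).filter fun p => p.1 ∈ Finset.Icc (-(M : ℤ)) M).card =
      ∑ j ∈ Finset.range (2 * M + 1), (2 * √(R - ((j : ℝ) - M) ^ 2) -
        2 * (Int.fract √(R - ((j : ℝ) - M) ^ 2) - 1 / 2)) := by
  rw [Finset.card_eq_sum_card_fiberwise (f := Prod.fst) (t := Finset.Icc (-(M : ℤ)) M)
    (s := (discPoints R).filter fun p => p.1 ∈ Finset.Icc (-(M : ℤ)) M)
    (fun p hp => (Finset.mem_filter.1 hp).2)]
  push_cast
  have h := sum_Icc_neg_eq_sum_range M (fun a => 2 * √(R - (a : ℝ) ^ 2) -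
        2 * (Int.fract √(R - (a : ℝ) ^ 2) - 1 / 2))
  push_cast at h
  rw [← h]
  refine Finset.sum_congr rfl fun a ha => ?_
  rw [← card_Icc_neg_floor_sqrt, Nat.cast_inj]
  have haR : (a : ℝ) ^ 2 ≤ R := by
    rw [Finset.mem_Icc] at ha
    have h1 : (-M : ℝ) ≤ a := by exact_mod_cast ha.1
    have h2 : (a : ℝ) ≤ M := by exact_mod_cast ha.2
    nlinarith
  refine Finset.card_nbij' (fun p => p.2) (fun b => (a, b)) ?_ ?_ ?_ ?_
  · intro p hp
    simp only [Finset.coe_filter, Set.mem_ofPred_eq, Finset.mem_filter, mem_discPoints hR] at hp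
    rw [Finset.mem_coe, mem_Icc_neg_floor_sqrt_iff (by linarith), ← hp.2]
    linarith [hp.1.1]
  · intro b hb
    rw [Finset.mem_coe, mem_Icc_neg_floor_sqrt_iff (by linarith)] at hb
    simp only [Finset.coe_filter, Set.mem_ofPred_eq, Finset.mem_filter, mem_discPoints hR]
    exact ⟨⟨by linarith, ha⟩, trivial⟩
  · intro p hp
    simp only [Finset.coe_filter, Set.mem_ofPred_eq] at hp
    exact Prod.ext hp.2.symm rfl
  · intro b _
    rfl

lemma card_discPoints_horizontal_strip {R : ℝ} (hR : 0 ≤ R) (M : ℕ) :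
    ((discPoints R).filter fun p => p.2 ∈ Finset.Icc (-(M : ℤ)) M).card =
      ((discPoints R).filter fun p => p.1 ∈ Finset.Icc (-(M : ℤ)) M).card := by
  refine Finset.card_nbij' Prod.swap Prod.swap ?_ ?_ (fun _ _ => Prod.swap_swap _)
    (fun _ _ => Prod.swap_swap _) <;>
  · intro p hp
    simp only [Finset.coe_filter, Set.mem_ofPred_eq, mem_discPoints hR, Prod.fst_swap,
      Prod.snd_swap] at hp ⊢
    exact ⟨by linarith [hp.1], hp.2⟩

lemma card_discPoints_add_square {R : ℝ} (hR : 0 ≤ R) :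
    (discPoints R).card + (2 * ⌊√(R / 2)⌋₊ + 1) ^ 2 =
      2 * ((discPoints R).filter fun p =>
        p.1 ∈ Finset.Icc (-(⌊√(R / 2)⌋₊ : ℤ)) ⌊√(R / 2)⌋₊).card := by
  have hL0 : 0 ≤ √(R / 2) := Real.sqrt_nonneg _
  have hfl : (⌊√(R / 2)⌋₊ : ℤ) = ⌊√(R / 2)⌋ := Int.natCast_floor_eq_floor hL0
  set M := ⌊√(R / 2)⌋₊
  have hmem : ∀ b : ℤ, b ∈ Finset.Icc (-(M : ℤ)) M ↔ (b : ℝ) ^ 2 ≤ R / 2 := fun b => by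
    rw [hfl]; exact mem_Icc_neg_floor_sqrt_iff (by positivity) b
  have hunion : ((discPoints R).filter fun p => p.1 ∈ Finset.Icc (-(M : ℤ)) M) ∪
      ((discPoints R).filter fun p => p.2 ∈ Finset.Icc (-(M : ℤ)) M) = discPoints R := by
    rw [← Finset.filter_or]
    refine Finset.filter_true_of_mem fun p hp => ?_
    rw [mem_discPoints hR] at hp
    rw [hmem, hmem]
    by_contra! h
    linarith [h.1, h.2]
  have hinter : ((discPoints R).filter fun p => p.1 ∈ Finset.Icc (-(M : ℤ)) M) ∩
      ((discPoints R).filter fun p => p.2 ∈ Finset.Icc (-(M : ℤ)) M) =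
      Finset.Icc (-(M : ℤ)) M ×ˢ Finset.Icc (-(M : ℤ)) M := by
    ext p
    simp only [Finset.mem_inter, Finset.mem_filter, mem_discPoints hR, Finset.mem_product, hmem]
    constructor
    · rintro ⟨⟨_, h1⟩, _, h2⟩
      exact ⟨h1, h2⟩
    · rintro ⟨h1, h2⟩
      exact ⟨⟨by linarith, h1⟩, by linarith, h2⟩
  have h := Finset.card_union_add_card_inter
    ((discPoints R).filter fun p => p.1 ∈ Finset.Icc (-(M : ℤ)) M)
    ((discPoints R).filter fun p => p.2 ∈ Finset.Icc (-(M : ℤ)) M)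
  have hsq : (Finset.Icc (-(M : ℤ)) M).card = 2 * M + 1 := by
    rw [Int.card_Icc]; omega
  rw [hunion, hinter, Finset.card_product, hsq, card_discPoints_horizontal_strip hR] at h
  rw [sq, h]
  ring

lemma card_discPoints_le_of_lt_four {R : ℝ} (hR : R < 4) : (discPoints R).card ≤ 9 := by
  have h : ⌊√R⌋ ≤ 1 := by
    have h2 : √R < 2 := (Real.sqrt_lt' (by norm_num)).2 (by linarith)
    have : ⌊√R⌋ < 2 := Int.floor_lt.2 (by exact_mod_cast h2)
    omega
  refine (Finset.card_filter_le _ _).trans ?_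
  rw [Finset.card_product, Int.card_Icc]
  have : (⌊√R⌋ + 1 - -⌊√R⌋).toNat ≤ 3 := by omega
  nlinarith

/-- The Gauss circle problem with error term `O(R^{1/3})`: there is a constant `C > 0`
such that for every real `R ≥ 1` the number of lattice points in the closed disc of
radius `√R` differs from `π R` by at most `C · R^{1/3}`. -/
theorem gauss_circle_error :
    ∃ C : ℝ, 0 < C ∧ ∀ R : ℝ, 1 ≤ R →
      |(({p : ℤ × ℤ | (p.1 : ℝ) ^ 2 + (p.2 : ℝ) ^ 2 ≤ R}.ncard : ℝ)) - Real.pi * R|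
        ≤ C * R ^ ((1 : ℝ) / 3) := by
  refine ⟨6602, by norm_num, fun R hR => ?_⟩
  have hR0 : 0 ≤ R := by linarith
  have hc : 1 ≤ R ^ ((1 : ℝ) / 3) := Real.one_le_rpow hR (by norm_num)
  rw [ncard_eq_card_discPoints hR0]
  rcases lt_or_ge R 4 with h4 | h4
  · have h : ((discPoints R).card : ℝ) ≤ 9 := by exact_mod_cast card_discPoints_le_of_lt_four h4
    have h0 : (0 : ℝ) ≤ (discPoints R).card := by positivity
    have hp := Real.pi_pos
    have hp4 := Real.pi_le_four
    rw [abs_le]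
    constructor <;> nlinarith
  · have hM : (⌊√(R / 2)⌋₊ : ℝ) ^ 2 ≤ R / 2 := by
      rw [← Real.le_sqrt (by positivity) (by positivity)]
      exact Nat.floor_le (Real.sqrt_nonneg _)
    have h1 := card_discPoints_vertical_strip hR0 (hM.trans (by linarith))
    rw [Finset.sum_sub_distrib, ← Finset.mul_sum, ← Finset.mul_sum] at h1
    have h2 : ((discPoints R).card : ℝ) + (2 * ⌊√(R / 2)⌋₊ + 1) ^ 2 =
      2 * ((discPoints R).filter fun p =>
        p.1 ∈ Finset.Icc (-(⌊√(R / 2)⌋₊ : ℤ)) ⌊√(R / 2)⌋₊).card := by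
      exact_mod_cast card_discPoints_add_square hR0
    rw [h1] at h2
    have h3 := abs_le.1 (abs_four_mul_sum_sqrt_sub_le h4)
    have h5 := abs_le.1 (abs_sum_fract_sqrt_le hR hM)
    rw [abs_le]
    constructor <;> linarith [h3.1, h3.2, h5.1, h5.2]
end
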